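/- arXiv:2308.07785 — 4 statements merged into one kernel-verified Lean document; each statement's English description precedes it below -/
import Mathlib

section
/- For every nonzero real number q, the subgroup Δ_q of SL(2,ℝ) generated by the matrices a = [[1,0],[1,1]] and b_q = [[1,q],[0,1]] is not virtually solvable. -/
open Matrix

/-- A group is virtually solvable if it has a solvable subgroup of finite index. -/
def IsVirtuallySolvable (G : Type*) [Group G] : Prop :=
  ∃ H : Subgroup G, H.FiniteIndex ∧ IsSolvable H

/-- The matrix `a = [[1,0],[1,1]]` in `SL(2,ℝ)`. -/
def aSL : SpecialLinearGroup (Fin 2) ℝ :=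
  ⟨!![1, 0; 1, 1], by simp [Matrix.det_fin_two_of]⟩

/-- The matrix `b_q = [[1,q],[0,1]]` in `SL(2,ℝ)`. -/
def bSL (q : ℝ) : SpecialLinearGroup (Fin 2) ℝ :=
  ⟨!![1, q; 0, 1], by simp [Matrix.det_fin_two_of]⟩

/-- The Lyndon–Ullman group `Δ_q`, generated by `a` and `b_q`. -/
def Δ (q : ℝ) : Subgroup (SpecialLinearGroup (Fin 2) ℝ) :=
  Subgroup.closure {aSL, bSL q}

lemma aux_real (p q r s x e t : ℝ) (hx : x ≠ 0) (hd : p * s - q * r = 1) (he : e = 1 ∨ e = -1)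
    (ht : t = r + (p - s) * x - q * x ^ 2)
    (h00 : p * (p - q * x) + q * t = e * ((p - q * x) * p + q * r))
    (h01 : p * q + q * (s + q * x) = e * ((p - q * x) * q + q * s))
    (h10 : r * (p - q * x) + s * t = e * (t * p + (s + q * x) * r))
    (h11 : r * q + s * (s + q * x) = e * (t * q + (s + q * x) * s)) :
    q = 0 ∧ p = s := by
  subst ht
  rcases he with rfl | rfl
  · have h1 : q ^ 2 * x = 0 := by linear_combination h01 / 2
    have hq : q = 0 := by
      rcases mul_eq_zero.1 h1 with h | h
      · exact pow_eq_zero_iff (two_ne_zero) |>.1 h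
      · exact absurd h hx
    subst hq
    have h2 : (p - s) ^ 2 * x = 0 := by linear_combination -h10
    rcases mul_eq_zero.1 h2 with h | h
    · exact ⟨rfl, sub_eq_zero.1 (pow_eq_zero_iff (two_ne_zero) |>.1 h)⟩
    · exact absurd h hx
  · exfalso
    have h1 : (p + s) * q = 0 := by linear_combination h01 / 2
    rcases mul_eq_zero.1 h1 with h | h
    · have hs : s = -p := by linarith
      subst hs
      nlinarith [sq_nonneg (q * x)]
    · subst h
      nlinarith [sq_nonneg p, sq_nonneg s, mul_self_nonneg (p + s), mul_self_nonneg (p - s)]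

def IsScal (g : SpecialLinearGroup (Fin 2) ℝ) : Prop :=
  g.1 0 1 = 0 ∧ g.1 1 0 = 0 ∧ g.1 0 0 = g.1 1 1

lemma scal_comm (g h : SpecialLinearGroup (Fin 2) ℝ) (hs : IsScal (g * h * g⁻¹ * h⁻¹)) :
    ∃ e : ℝ, (e = 1 ∨ e = -1) ∧ ∀ i j, (g.1 * h.1) i j = e * (h.1 * g.1) i j := by
  set c := g * h * g⁻¹ * h⁻¹ with hc
  have hgh : g * h = c * (h * g) := by rw [hc]; group
  obtain ⟨h1, h2, h3⟩ := hs
  have hd := c.2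
  rw [Matrix.det_fin_two, h1, h2, ← h3] at hd
  refine ⟨c.1 0 0, ?_, ?_⟩
  · apply mul_self_eq_one_iff.1
    linarith
  · have hm : g.1 * h.1 = c.1 * (h.1 * g.1) := congrArg Subtype.val hgh
    intro i j
    rw [hm]
    generalize h.1 * g.1 = M
    rw [Matrix.mul_apply, Fin.sum_univ_two]
    fin_cases i <;> simp [h1, h2, h3]

lemma lower_step (g l : SpecialLinearGroup (Fin 2) ℝ) (x : ℝ) (hx : x ≠ 0)
    (hl : l.1 = !![1, 0; x, 1])
    (hs : IsScal (g * (l * g * l⁻¹) * g⁻¹ * (l * g * l⁻¹)⁻¹)) :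
    g.1 0 1 = 0 ∧ g.1 0 0 = g.1 1 1 := by
  obtain ⟨e, he, hm⟩ := scal_comm _ _ hs
  have hd := g.2
  rw [Matrix.det_fin_two] at hd
  have hh : (l * g * l⁻¹).1 = !![g.1 0 0 - g.1 0 1 * x, g.1 0 1;
      g.1 1 0 + (g.1 0 0 - g.1 1 1) * x - g.1 0 1 * x ^ 2, g.1 1 1 + g.1 0 1 * x] := by
    have h0 : (l * g * l⁻¹).1 = l.1 * g.1 * adjugate l.1 := rfl
    rw [h0, hl, Matrix.adjugate_fin_two_of]
    ext i j
    fin_cases i <;> fin_cases j <;> simp [Matrix.mul_apply, Matrix.vecMul, dotProduct, Fin.sum_univ_two] <;> ring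
  rw [hh] at hm
  have h00 := hm 0 0
  have h01 := hm 0 1
  have h10 := hm 1 0
  have h11 := hm 1 1
  simp [Matrix.mul_apply, Fin.sum_univ_two] at h00 h01 h10 h11
  exact aux_real _ _ _ _ x e _ hx hd he rfl h00 h01 h10 h11

lemma upper_step (g l : SpecialLinearGroup (Fin 2) ℝ) (x : ℝ) (hx : x ≠ 0)
    (hl : l.1 = !![1, x; 0, 1])
    (hs : IsScal (g * (l * g * l⁻¹) * g⁻¹ * (l * g * l⁻¹)⁻¹)) :
    g.1 1 0 = 0 := by
  obtain ⟨e, he, hm⟩ := scal_comm _ _ hs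
  have hd := g.2
  rw [Matrix.det_fin_two] at hd
  have hh : (l * g * l⁻¹).1 = !![g.1 0 0 + g.1 1 0 * x,
      g.1 0 1 + (g.1 1 1 - g.1 0 0) * x - g.1 1 0 * x ^ 2; g.1 1 0, g.1 1 1 - g.1 1 0 * x] := by
    have h0 : (l * g * l⁻¹).1 = l.1 * g.1 * adjugate l.1 := rfl
    rw [h0, hl, Matrix.adjugate_fin_two_of]
    ext i j
    fin_cases i <;> fin_cases j <;> simp [Matrix.mul_apply, Matrix.vecMul, dotProduct, Fin.sum_univ_two] <;> ring
  rw [hh] at hm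
  have h00 := hm 0 0
  have h01 := hm 0 1
  have h10 := hm 1 0
  have h11 := hm 1 1
  simp [Matrix.mul_apply, Fin.sum_univ_two] at h00 h01 h10 h11
  exact (aux_real (g.1 1 1) (g.1 1 0) (g.1 0 1) (g.1 0 0) x e _ hx (by linarith) he rfl
    (by linarith) (by linarith) (by linarith) (by linarith)).1

open scoped commutatorElement in
lemma not_solvable_aux {G : Type*} [Group G] [hG : Group.IsSolvable G]
    (φ : G →* SpecialLinearGroup (Fin 2) ℝ) (l u : G) (x y : ℝ) (hx : x ≠ 0) (hy : y ≠ 0)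
    (hl : (φ l).1 = !![1, 0; x, 1]) (hu : (φ u).1 = !![1, y; 0, 1]) : False := by
  have key : ∀ n, (∀ g ∈ derivedSeries G n, IsScal (φ g)) →
      ∀ g ∈ derivedSeries G 0, IsScal (φ g) := by
    intro n
    induction n with
    | zero => exact id
    | succ k ih =>
      intro H
      apply ih
      intro g hg
      have hc : ∀ v : G, IsScal (φ g * (φ v * φ g * (φ v)⁻¹) * (φ g)⁻¹ *
          (φ v * φ g * (φ v)⁻¹)⁻¹) := by
        intro v
        have h1 : v * g * v⁻¹ ∈ derivedSeries G k :=
          (derivedSeries_normal G k).conj_mem g hg v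
        have h2 := H ⁅g, v * g * v⁻¹⁆ (by
          rw [derivedSeries_succ]
          exact Subgroup.commutator_mem_commutator hg h1)
        simpa only [commutatorElement_def, map_mul, map_inv] using h2
      obtain ⟨h1, h2⟩ := lower_step _ _ x hx hl (hc l)
      exact ⟨h1, upper_step _ _ y hy hu (hc u), h2⟩
  obtain ⟨n, hn⟩ := hG.solvable
  have := key n (by
    intro g hg
    rw [hn, Subgroup.mem_bot] at hg
    subst hg
    simp [IsScal]) l (by simp)
  have h := this.2.1
  rw [hl] at h
  exact hx (by simpa using h)

lemma aSL_pow (n : ℕ) : (aSL ^ n).1 = !![1, 0; (n : ℝ), 1] := by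
  induction n with
  | zero => ext i j; fin_cases i <;> fin_cases j <;> simp
  | succ k ih =>
    have h0 : (aSL ^ k * aSL).1 = (aSL ^ k).1 * (aSL).1 := rfl
    rw [pow_succ, h0, ih]
    ext i j
    fin_cases i <;> fin_cases j <;> simp [aSL, Matrix.mul_apply, Fin.sum_univ_two]

lemma bSL_pow (q : ℝ) (n : ℕ) : (bSL q ^ n).1 = !![1, (n : ℝ) * q; 0, 1] := by
  induction n with
  | zero => ext i j; fin_cases i <;> fin_cases j <;> simp
  | succ k ih =>
    have h0 : (bSL q ^ k * bSL q).1 = (bSL q ^ k).1 * (bSL q).1 := rfl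
    rw [pow_succ, h0, ih]
    ext i j
    fin_cases i <;> fin_cases j <;> simp [bSL, Matrix.mul_apply, Fin.sum_univ_two]
    ring

/-- For every nonzero real `q`, the group `Δ_q` is not virtually solvable. -/
theorem Δ_not_virtuallySolvable (q : ℝ) (hq : q ≠ 0) :
    ¬ IsVirtuallySolvable (Δ q) := by
  rintro ⟨H, hH, hS⟩
  haveI hS2 : Group.IsSolvable H := hS
  have ha : aSL ∈ Δ q := Subgroup.subset_closure (by simp)
  have hb : bSL q ∈ Δ q := Subgroup.subset_closure (by simp)
  obtain ⟨m, hm, -, hma⟩ := Subgroup.exists_pow_mem_of_index_ne_zero hH.index_ne_zero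
    (⟨aSL, ha⟩ : Δ q)
  obtain ⟨n, hn, -, hnb⟩ := Subgroup.exists_pow_mem_of_index_ne_zero hH.index_ne_zero
    (⟨bSL q, hb⟩ : Δ q)
  exact not_solvable_aux ((Δ q).subtype.comp H.subtype) ⟨_, hma⟩ ⟨_, hnb⟩ (m : ℝ) (n * q)
    (by exact_mod_cast hm.ne') (mul_ne_zero (by exact_mod_cast hn.ne') hq)
    (aSL_pow m) (bSL_pow q n)
end

section
/- Let p be a prime, d ≥ 1, and let X be a d×d matrix over ℚ_p with ‖X‖ ≤ p⁻², where ‖·‖ denotes the supremum of the p-adic absolute values of the entries; then the exponential series exp(p^n X) = ∑_k (p^n X)^k / k! converges for every n ≥ 0, and for every d×d matrix v over ℚ_p, the sequence p^{-n}·( exp(p^n X) · v · exp(p^n X)^{-1} − v ) converges to Xv − vX as n → ∞. -/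
open Filter

/-- The norm of a matrix over `ℚ_p`: the supremum of the `p`-adic absolute values of the
entries. -/
noncomputable def matNorm {p : ℕ} [Fact p.Prime] {d : ℕ}
    (A : Matrix (Fin d) (Fin d) ℚ_[p]) : ℝ :=
  ⨆ i, ⨆ j, ‖A i j‖

section helpers
variable {p : ℕ} [hp : Fact p.Prime] {d : ℕ}

lemma entry_le (A : Matrix (Fin d) (Fin d) ℚ_[p]) (i j : Fin d) : ‖A i j‖ ≤ matNorm A :=
  le_trans (le_ciSup (f := fun j => ‖A i j‖) (Set.finite_range _).bddAbove j)
    (le_ciSup (f := fun i => ⨆ j, ‖A i j‖) (Set.finite_range _).bddAbove i)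

lemma pow_entry_le (X : Matrix (Fin d) (Fin d) ℚ_[p]) (hX : matNorm X ≤ ((p : ℝ) ^ 2)⁻¹)
    (k : ℕ) : ∀ i j, ‖(X ^ k) i j‖ ≤ (((p : ℝ) ^ 2)⁻¹) ^ k := by
  induction k with
  | zero =>
    intro i j
    rw [pow_zero, pow_zero, Matrix.one_apply]
    split_ifs <;> simp
  | succ k ih =>
    intro i j
    rw [pow_succ, Matrix.mul_apply]
    apply IsUltrametricDist.norm_sum_le_of_forall_le_of_nonneg (by positivity)
    intro l _
    rw [norm_mul, pow_succ]
    exact mul_le_mul (ih i l) ((entry_le X l j).trans hX) (norm_nonneg _) (by positivity)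

lemma fact_norm_le (k : ℕ) : ‖((k.factorial : ℚ_[p]))⁻¹‖ ≤ (p : ℝ) ^ k := by
  have h0 : ((k.factorial : ℚ_[p])) ≠ 0 := by exact_mod_cast k.factorial_ne_zero
  have h1 : (1 : ℝ) ≤ p := by exact_mod_cast hp.out.one_lt.le
  rw [norm_inv, Padic.norm_eq_zpow_neg_valuation h0, Padic.valuation_natCast, zpow_neg, inv_inv,
    zpow_natCast]
  apply pow_le_pow_right₀ h1
  rcases Nat.eq_zero_or_pos k with rfl | hk
  · simp
  · have h2 := sub_one_mul_padicValNat_factorial_lt_of_ne_zero p hk.ne'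
    have h3 : 1 ≤ p - 1 := by have := hp.out.two_le; omega
    nlinarith

lemma coef_le (X : Matrix (Fin d) (Fin d) ℚ_[p]) (hX : matNorm X ≤ ((p : ℝ) ^ 2)⁻¹)
    (k : ℕ) (i j) : ‖((k.factorial : ℚ_[p]))⁻¹ * (X ^ k) i j‖ ≤ ((p : ℝ)⁻¹) ^ k := by
  have h0 : (p : ℝ) ≠ 0 := by exact_mod_cast hp.out.ne_zero
  rw [norm_mul]
  refine (mul_le_mul (fact_norm_le k) (pow_entry_le X hX k i j) (norm_nonneg _)
    (by positivity)).trans (le_of_eq ?_)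
  rw [← mul_pow]
  congr 1
  field_simp

lemma geo_summable : Summable (fun k : ℕ => ((p : ℝ)⁻¹) ^ k) := by
  apply summable_geometric_of_lt_one (by positivity)
  apply inv_lt_one_of_one_lt₀
  exact_mod_cast hp.out.one_lt

lemma p_pow_norm_le (n : ℕ) : ‖((p : ℚ_[p]) ^ n)‖ ≤ 1 := by
  rw [norm_pow]
  exact pow_le_one₀ (norm_nonneg _) Padic.norm_p_lt_one.le

lemma p_pow_pow_norm_le (n k : ℕ) : ‖((p : ℚ_[p]) ^ n) ^ k‖ ≤ 1 := by
  rw [norm_pow]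
  exact pow_le_one₀ (norm_nonneg _) (p_pow_norm_le n)

lemma term_le (X : Matrix (Fin d) (Fin d) ℚ_[p]) (hX : matNorm X ≤ ((p : ℝ) ^ 2)⁻¹)
    (n m k : ℕ) (i j) :
    ‖((p : ℚ_[p]) ^ n) ^ m * (((k.factorial : ℚ_[p]))⁻¹ * (X ^ k) i j)‖ ≤ ((p : ℝ)⁻¹) ^ k := by
  rw [norm_mul]
  exact (mul_le_of_le_one_left (norm_nonneg _) (p_pow_pow_norm_le n m)).trans (coef_le X hX k i j)

end helpers

theorem padic_exp_conj_deriv (p : ℕ) [Fact p.Prime] (d : ℕ) (hd : 1 ≤ d)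
    (X : Matrix (Fin d) (Fin d) ℚ_[p]) (hX : matNorm X ≤ ((p : ℝ) ^ 2)⁻¹) :
    ∃ E : ℕ → Matrix (Fin d) (Fin d) ℚ_[p],
      (∀ n : ℕ, Tendsto
        (fun N : ℕ => ∑ k ∈ Finset.range N,
          ((k.factorial : ℚ_[p]))⁻¹ • (((p : ℚ_[p]) ^ n) • X) ^ k)
        atTop (nhds (E n))) ∧
      ∀ v : Matrix (Fin d) (Fin d) ℚ_[p],
        Tendsto (fun n : ℕ => (((p : ℚ_[p]) ^ n)⁻¹) • (E n * v * (E n)⁻¹ - v))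
          atTop (nhds (X * v - v * X)) := by
  have hpp : (p : ℚ_[p]) ≠ 0 := by exact_mod_cast (Fact.out : p.Prime).ne_zero
  have hsum : ∀ n i j, Summable (fun k : ℕ =>
      ((p : ℚ_[p]) ^ n) ^ k * (((k.factorial : ℚ_[p]))⁻¹ * (X ^ k) i j)) := fun n i j =>
    Summable.of_norm_bounded geo_summable (fun k => term_le X hX n k k i j)
  let E : ℕ → Matrix (Fin d) (Fin d) ℚ_[p] := fun n => Matrix.of fun i j =>
    ∑' k : ℕ, ((p : ℚ_[p]) ^ n) ^ k * (((k.factorial : ℚ_[p]))⁻¹ * (X ^ k) i j)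
  let D : ℕ → Matrix (Fin d) (Fin d) ℚ_[p] := fun n => Matrix.of fun i j =>
    ∑' k : ℕ, ((p : ℚ_[p]) ^ n) ^ k * ((((k + 1).factorial : ℚ_[p]))⁻¹ * (X ^ (k + 1)) i j)
  have hp0 : Tendsto (fun n : ℕ => (p : ℚ_[p]) ^ n) atTop (nhds 0) :=
    tendsto_pow_atTop_nhds_zero_of_norm_lt_one Padic.norm_p_lt_one
  have hED : ∀ n, E n = 1 + ((p : ℚ_[p]) ^ n) • D n := by
    intro n
    ext i j
    simp only [E, D, Matrix.of_apply, Matrix.add_apply, Matrix.smul_apply, smul_eq_mul]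
    rw [(hsum n i j).tsum_eq_zero_add, ← tsum_mul_left]
    congr 1
    · simp
    · apply tsum_congr
      intro k
      ring
  have hD : Tendsto D atTop (nhds X) := by
    refine tendsto_pi_nhds.2 fun i => tendsto_pi_nhds.2 fun j => ?_
    have hX' : X i j = ∑' k : ℕ, if k = 0 then X i j else 0 := by rw [tsum_ite_eq]
    rw [hX']
    refine tendsto_tsum_of_dominated_convergence
      (bound := fun k : ℕ => ((p : ℝ)⁻¹) ^ (k + 1))
      ((summable_nat_add_iff 1).2 geo_summable) ?_ ?_
    · intro k
      rcases Nat.eq_zero_or_pos k with rfl | hk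
      · simp
      · rw [if_neg hk.ne']
        have := (hp0.pow k).mul_const ((((k + 1).factorial : ℚ_[p]))⁻¹ * (X ^ (k + 1)) i j)
        rwa [zero_pow hk.ne', zero_mul] at this
    · exact Eventually.of_forall fun n k => term_le X hX n k (k + 1) i j
  have hE : Tendsto E atTop (nhds 1) := by
    have h := (hp0.smul hD).const_add (1 : Matrix (Fin d) (Fin d) ℚ_[p])
    rw [zero_smul, add_zero] at h
    exact h.congr fun n => (hED n).symm
  have hdet : Tendsto (fun n => (E n).det) atTop (nhds 1) := by
    have h := ((continuous_id.matrix_det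
      (A := (id : Matrix (Fin d) (Fin d) ℚ_[p] → _))).tendsto 1).comp hE
    simpa [Function.comp_def] using h
  have hne : ∀ᶠ n in atTop, (E n).det ≠ 0 := hdet.eventually_ne one_ne_zero
  have hinv : Tendsto (fun n => (E n)⁻¹) atTop (nhds 1) := by
    have hadj : Tendsto (fun n => (E n).adjugate) atTop (nhds 1) := by
      have h := ((continuous_id.matrix_adjugate
        (A := (id : Matrix (Fin d) (Fin d) ℚ_[p] → _))).tendsto 1).comp hE
      simpa [Function.comp_def] using h
    have h := (hdet.inv₀ one_ne_zero).smul hadj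
    rw [inv_one, one_smul] at h
    refine h.congr fun n => ?_
    rw [Matrix.inv_def, Ring.inverse_eq_inv']
  refine ⟨E, fun n => ?_, fun v => ?_⟩
  · refine tendsto_pi_nhds.2 fun i => tendsto_pi_nhds.2 fun j => ?_
    refine ((hsum n i j).hasSum.tendsto_sum_nat).congr fun N => ?_
    rw [Matrix.sum_apply]
    refine Finset.sum_congr rfl fun k _ => ?_
    rw [smul_pow, Matrix.smul_apply, Matrix.smul_apply, smul_eq_mul, smul_eq_mul]
    ring
  · have h := ((hD.mul_const v).sub (hD.const_mul v)).mul hinv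
    rw [mul_one] at h
    refine h.congr' ?_
    filter_upwards [hne] with n hn
    have hu : IsUnit (E n).det := isUnit_iff_ne_zero.2 hn
    have h1 : E n * v * (E n)⁻¹ - v = (E n * v - v * E n) * (E n)⁻¹ := by
      rw [sub_mul, Matrix.mul_nonsing_inv_cancel_right _ _ hu]
    have h2 : E n * v - v * E n = ((p : ℚ_[p]) ^ n) • (D n * v - v * D n) := by
      rw [hED n, add_mul, mul_add, one_mul, mul_one, smul_mul_assoc, mul_smul_comm, smul_sub]
      abel
    rw [h1, h2, smul_mul_assoc, smul_smul, inv_mul_cancel₀ (pow_ne_zero _ hpp), one_smul]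
end

section
/- Let p be a prime, d ≥ 1, and let X be a d×d matrix over ℚ_p with ‖X‖ ≤ p⁻², where ‖·‖ denotes the supremum of the p-adic absolute values of the entries (so that exp(X) = ∑_k X^k/k! converges). Let V be a ℚ_p-linear subspace of the d×d matrices over ℚ_p such that exp(X) · V · exp(X)^{-1} = V. Then XV − VX ⊆ V; that is, V is invariant under the map v ↦ Xv − vX. -/
open Filter

open Topology

section Abstract

variable {p : ℕ} [Fact p.Prime] {A : Type*} [NormedRing A] [NormedAlgebra ℚ_[p] A]

lemma aux_norm_factorial_inv (n : ℕ) : ‖((n.factorial : ℚ_[p]))⁻¹‖ ≤ (p : ℝ) ^ n := by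
  have hp : (1 : ℝ) ≤ p := by exact_mod_cast (Fact.out : p.Prime).one_le
  rw [norm_inv, Padic.norm_eq_zpow_neg_valuation (p := p)
    (x := (n.factorial : ℚ_[p])) (by exact_mod_cast n.factorial_ne_zero),
    ← zpow_neg, neg_neg, Padic.valuation_natCast, zpow_natCast]
  exact pow_le_pow_right₀ hp (padicValNat_factorial_le p n)

lemma aux_radius : (((p : NNReal)⁻¹ : NNReal) : ENNReal) ≤ (NormedSpace.expSeries ℚ_[p] A).radius := by
  have hp : (0 : ℝ) < p := by exact_mod_cast (Fact.out : p.Prime).pos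
  refine FormalMultilinearSeries.le_radius_of_bound _ (max 1 ‖(1 : A)‖) fun n => ?_
  rw [NormedSpace.expSeries, norm_smul]
  have h1 := aux_norm_factorial_inv (p := p) n
  have h2 := ContinuousMultilinearMap.norm_mkPiAlgebraFin_le (𝕜 := ℚ_[p]) (A := A) (n := n)
  calc _ ≤ ((p : ℝ) ^ n * max 1 ‖(1 : A)‖) * ((p : ℝ)⁻¹) ^ n := by
        push_cast
        gcongr
    _ = _ := by
        rw [inv_pow]
        field_simp

lemma aux_mem_ball (x : A) (hx : ‖x‖ ≤ ((p : ℝ) ^ 2)⁻¹) :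
    x ∈ Metric.eball (0 : A) (NormedSpace.expSeries ℚ_[p] A).radius := by
  have hp : (1 : ℝ) < p := by exact_mod_cast (Fact.out : p.Prime).one_lt
  refine Metric.eball_subset_eball aux_radius ?_
  rw [Metric.eball_coe, mem_ball_zero_iff]
  refine hx.trans_lt ?_
  push_cast
  apply inv_strictAnti₀ (by positivity)
  nlinarith

variable [CompleteSpace A]

lemma aux_exp_nat (x : A) (hx : ‖x‖ ≤ ((p : ℝ) ^ 2)⁻¹) (n : ℕ) :
    NormedSpace.exp ((n : ℚ_[p]) • x) = NormedSpace.exp x ^ n := by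
  have key : ∀ k : ℕ, ‖(k : ℚ_[p]) • x‖ ≤ ((p : ℝ) ^ 2)⁻¹ := fun k => by
    rw [norm_smul]
    have := IsUltrametricDist.norm_natCast_le_one ℚ_[p] k
    nlinarith [norm_nonneg x]
  induction n with
  | zero => simp
  | succ n ih =>
    push_cast
    rw [add_smul, one_smul, pow_succ, ← ih]
    exact NormedSpace.exp_add_of_commute_of_mem_ball (𝕂 := ℚ_[p])
      ((Commute.refl x).smul_left _) (aux_mem_ball _ (key n)) (aux_mem_ball _ hx)

lemma aux_tendsto (x : A) (hx : ‖x‖ ≤ ((p : ℝ) ^ 2)⁻¹) :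
    Tendsto (fun m : ℕ => ((p : ℚ_[p]) ^ m)⁻¹ • (NormedSpace.exp x ^ (p ^ m) - 1))
      atTop (𝓝 x) := by
  have hp : (1 : ℝ) < p := by exact_mod_cast (Fact.out : p.Prime).one_lt
  have hp0 : (p : ℚ_[p]) ≠ 0 := by exact_mod_cast (Fact.out : p.Prime).ne_zero
  have hpos : 0 < (NormedSpace.expSeries ℚ_[p] A).radius := by
    refine lt_of_lt_of_le ?_ aux_radius
    have : (0 : NNReal) < (p : NNReal)⁻¹ := by
      have : 0 < p := (Fact.out : p.Prime).pos
      positivity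
    exact_mod_cast this
  have h0 := hasFDerivAt_exp_zero_of_radius_pos hpos
  have h1 : HasDerivAt (fun t : ℚ_[p] => t • x) x 0 := by
    simpa using (hasDerivAt_id (0 : ℚ_[p])).smul_const x
  have h2 : HasDerivAt (fun t : ℚ_[p] => NormedSpace.exp (t • x)) x 0 := by
    have h0' : HasFDerivAt (NormedSpace.exp : A → A) (1 : A →L[ℚ_[p]] A) ((0 : ℚ_[p]) • x) := by
      simpa using h0
    exact h0'.comp_hasDerivAt (0 : ℚ_[p]) h1
  have h3 := h2.tendsto_slope_zero
  have h4 : Tendsto (fun m : ℕ => (p : ℚ_[p]) ^ m) atTop (𝓝[≠] 0) := by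
    refine tendsto_nhdsWithin_iff.2 ⟨tendsto_pow_atTop_nhds_zero_of_norm_lt_one ?_,
      Eventually.of_forall fun m => pow_ne_zero m hp0⟩
    exact Padic.norm_p_lt_one
  refine (h3.comp h4).congr fun m => ?_
  have := aux_exp_nat x hx (p ^ m)
  push_cast at this
  simp [this]

lemma aux_conj (x : A) (hx : ‖x‖ ≤ ((p : ℝ) ^ 2)⁻¹) (hu : IsUnit (NormedSpace.exp x)) (v : A) :
    Tendsto (fun m : ℕ => ((p : ℚ_[p]) ^ m)⁻¹ •
      (NormedSpace.exp x ^ (p ^ m) * v * Ring.inverse (NormedSpace.exp x ^ (p ^ m)) - v))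
      atTop (𝓝 (x * v - v * x)) := by
  have hp0 : (p : ℚ_[p]) ≠ 0 := by exact_mod_cast (Fact.out : p.Prime).ne_zero
  have h := aux_tendsto x hx
  have hE : Tendsto (fun m : ℕ => NormedSpace.exp x ^ (p ^ m)) atTop (𝓝 1) := by
    have h4 : Tendsto (fun m : ℕ => (p : ℚ_[p]) ^ m) atTop (𝓝 0) :=
      tendsto_pow_atTop_nhds_zero_of_norm_lt_one Padic.norm_p_lt_one
    have := (h4.smul h).add_const 1
    simp only [zero_smul, zero_add] at this
    refine this.congr fun m => ?_
    rw [smul_inv_smul₀ (pow_ne_zero m hp0), sub_add_cancel]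
  have hI : Tendsto (fun m : ℕ => Ring.inverse (NormedSpace.exp x ^ (p ^ m))) atTop (𝓝 1) := by
    have := (NormedRing.inverse_continuousAt (1 : Aˣ)).tendsto
    simp only [Units.val_one, Ring.inverse_one] at this
    exact this.comp hE
  have := ((h.mul_const v).sub (h.const_mul v)).mul hI
  rw [mul_one] at this
  refine this.congr fun m => ?_
  have hm := Ring.mul_inverse_cancel _ (hu.pow (p ^ m))
  rw [smul_mul_assoc, mul_smul_comm, ← smul_sub, smul_mul_assoc]
  congr 1
  simp only [sub_mul, mul_sub, one_mul, mul_one, mul_assoc, hm]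
  abel

lemma aux_conj_of_tendsto (x : A) (hx : ‖x‖ ≤ ((p : ℝ) ^ 2)⁻¹) (E : A)
    (hE : Tendsto
      (fun N : ℕ => ∑ k ∈ Finset.range N, ((k.factorial : ℚ_[p]))⁻¹ • x ^ k) atTop (𝓝 E))
    (hu : IsUnit E) (v : A) :
    Tendsto (fun m : ℕ => ((p : ℚ_[p]) ^ m)⁻¹ •
      (E ^ (p ^ m) * v * Ring.inverse (E ^ (p ^ m)) - v)) atTop (𝓝 (x * v - v * x)) := by
  have hexp : NormedSpace.exp x = E := by
    refine tendsto_nhds_unique ?_ hE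
    exact (NormedSpace.expSeries_hasSum_exp_of_mem_ball' (𝕂 := ℚ_[p]) x
      (aux_mem_ball x hx)).tendsto_sum_nat
  subst hexp
  exact aux_conj x hx hu v

end Abstract

/-- Let `X` be a `d×d` matrix over `ℚ_p` with `‖X‖ ≤ p⁻²`, and let `E = exp(X)` be the sum
of the exponential series. If a `ℚ_p`-subspace `V` of the `d×d` matrices satisfies
`E V E⁻¹ = V`, then `XV − VX ⊆ V`, i.e. `V` is invariant under `v ↦ Xv − vX`. -/
theorem submodule_invariant_of_exp_conj_invariant (p : ℕ) [Fact p.Prime] (d : ℕ) (hd : 1 ≤ d)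
    (X : Matrix (Fin d) (Fin d) ℚ_[p]) (hX : matNorm X ≤ ((p : ℝ) ^ 2)⁻¹)
    (E : Matrix (Fin d) (Fin d) ℚ_[p])
    (hE : Tendsto
      (fun N : ℕ => ∑ k ∈ Finset.range N, ((k.factorial : ℚ_[p]))⁻¹ • X ^ k)
      atTop (nhds E))
    (V : Submodule ℚ_[p] (Matrix (Fin d) (Fin d) ℚ_[p]))
    (hV : (fun v => E * v * E⁻¹) '' (V : Set (Matrix (Fin d) (Fin d) ℚ_[p])) =
      (V : Set (Matrix (Fin d) (Fin d) ℚ_[p]))) :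
    ∀ v ∈ V, X * v - v * X ∈ V := by
  have hp : (1 : ℝ) < p := by exact_mod_cast (Fact.out : p.Prime).one_lt
  by_cases hu : IsUnit E
  swap
  · intro v hv
    have hz : E⁻¹ = 0 := Matrix.nonsing_inv_apply_not_isUnit _
      (fun h => hu ((Matrix.isUnit_iff_isUnit_det E).2 h))
    have h0 : ∀ w ∈ V, w = 0 := by
      intro w hw
      have : w ∈ (V : Set (Matrix (Fin d) (Fin d) ℚ_[p])) := hw
      rw [← hV] at this
      obtain ⟨u, -, rfl⟩ := this
      simp [hz]
    rw [h0 v hv]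
    simp
  have hclosed : IsClosed (V : Set (Matrix (Fin d) (Fin d) ℚ_[p])) :=
    V.closed_of_finiteDimensional
  let : NormedRing (Matrix (Fin d) (Fin d) ℚ_[p]) :=
    { (Matrix.normedAddCommGroup : NormedAddCommGroup (Matrix (Fin d) (Fin d) ℚ_[p])),
      (inferInstance : Ring (Matrix (Fin d) (Fin d) ℚ_[p])) with
      norm_mul_le := fun a b => by
        let : NormedAddCommGroup (Matrix (Fin d) (Fin d) ℚ_[p]) := Matrix.normedAddCommGroup
        change ‖a * b‖ ≤ ‖a‖ * ‖b‖
        refine (Matrix.norm_le_iff (by positivity)).2 fun i j => ?_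
        rw [Matrix.mul_apply]
        refine IsUltrametricDist.norm_sum_le_of_forall_le_of_nonneg (by positivity) fun k _ => ?_
        rw [norm_mul]
        exact mul_le_mul (Matrix.norm_entry_le_entrywise_sup_norm a)
          (Matrix.norm_entry_le_entrywise_sup_norm b) (norm_nonneg _) (norm_nonneg _) }
  let : NormedAlgebra ℚ_[p] (Matrix (Fin d) (Fin d) ℚ_[p]) :=
    { (inferInstance : Algebra ℚ_[p] (Matrix (Fin d) (Fin d) ℚ_[p])) with
      norm_smul_le := (Matrix.normedSpace :
        NormedSpace ℚ_[p] (Matrix (Fin d) (Fin d) ℚ_[p])).norm_smul_le }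
  have : @CompleteSpace (Matrix (Fin d) (Fin d) ℚ_[p]) PseudoMetricSpace.toUniformSpace :=
    inferInstanceAs (CompleteSpace (Fin d → Fin d → ℚ_[p]))
  have hX' : ‖X‖ ≤ ((p : ℝ) ^ 2)⁻¹ := by
    refine (Matrix.norm_le_iff (by positivity)).2 fun i j => ?_
    refine le_trans ?_ hX
    exact (le_ciSup (f := fun j => ‖X i j‖) (Set.finite_range _).bddAbove j).trans
      (le_ciSup (f := fun i => ⨆ j, ‖X i j‖) (Set.finite_range _).bddAbove i)
  have hpow : ∀ n : ℕ, ∀ v ∈ V, E ^ n * v * (E⁻¹) ^ n ∈ V := by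
    intro n
    induction n with
    | zero => intro v hv; simpa using hv
    | succ n ih =>
      intro v hv
      have h1 : E * v * E⁻¹ ∈ V := by
        have : E * v * E⁻¹ ∈ (V : Set (Matrix (Fin d) (Fin d) ℚ_[p])) := by
          rw [← hV]
          exact ⟨v, hv, rfl⟩
        exact this
      have := ih _ h1
      rw [pow_succ, pow_succ']
      simpa only [mul_assoc] using this
  intro v hv
  have hlim := aux_conj_of_tendsto X hX' E hE hu v
  refine hclosed.mem_of_tendsto hlim (Eventually.of_forall fun m => ?_)
  refine V.smul_mem _ (V.sub_mem ?_ hv)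
  rw [← Matrix.nonsing_inv_eq_ringInverse, ← Matrix.inv_pow']
  exact hpow _ v hv
end

section
/- Let G be a group and N a finite normal subgroup of G such that the quotient group G/N is coherent. Then G is coherent. -/
/-- A group is finitely presented if it is isomorphic to the quotient of a finitely
generated free group by the normal closure of finitely many relators. -/
def FinitelyPresented (G : Type*) [Group G] : Prop :=
  ∃ (m : ℕ) (rels : Set (FreeGroup (Fin m))),
    rels.Finite ∧ Nonempty (PresentedGroup rels ≃* G)

/-- A group is coherent if every finitely generated subgroup of it is finitely presented. -/
def IsCoherent (G : Type*) [Group G] : Prop :=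
  ∀ H : Subgroup G, Group.FG H → FinitelyPresented H

theorem fp_ext {H Q : Type*} [Group H] [Group Q] (f : H →* Q)
    (hf : Function.Surjective f) (hfin : Finite f.ker)
    (hQ : Group.IsFinitelyPresented Q) : Group.IsFinitelyPresented H := by
  classical
  obtain ⟨n, φ, hφ, T, hT, hTk⟩ := hQ.out
  choose g hg using fun i : Fin n => hf (φ (FreeGroup.of i))
  let α := Fin n ⊕ f.ker
  let ψ : FreeGroup α →* H := FreeGroup.lift (Sum.elim g (fun k => (k : H)))
  let ι : FreeGroup (Fin n) →* FreeGroup α := FreeGroup.lift (fun i => FreeGroup.of (Sum.inl i))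
  let p : FreeGroup α →* FreeGroup (Fin n) :=
    FreeGroup.lift (Sum.elim FreeGroup.of (fun _ => 1))
  let a : f.ker → FreeGroup α := fun k => FreeGroup.of (Sum.inr k)
  have hψa : ∀ k, ψ (a k) = k := fun k => by simp [ψ, a]
  have hfι : ∀ u, f (ψ (ι u)) = φ u := by
    have : (f.comp ψ).comp ι = φ := by
      ext i
      simp [ψ, ι, hg]
    intro u
    exact DFunLike.congr_fun this u
  have hfp : ∀ w, φ (p w) = f (ψ w) := by
    have : φ.comp p = f.comp ψ := by
      ext i
      rcases i with i | k
      · simp [ψ, p, hg]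
      · have := k.2
        rw [MonoidHom.mem_ker] at this
        simp [ψ, p, this]
    intro u
    exact DFunLike.congr_fun this u
  have hψ : Function.Surjective ψ := by
    intro h
    obtain ⟨u, hu⟩ := hφ (f h)
    have hk : (ψ (ι u))⁻¹ * h ∈ f.ker := by
      rw [MonoidHom.mem_ker, map_mul, map_inv, hfι, hu, inv_mul_cancel]
    refine ⟨ι u * a ⟨_, hk⟩, ?_⟩
    rw [map_mul, hψa]
    simp
  have hTm : ∀ t : T, ψ (ι t) ∈ f.ker := by
    intro t
    rw [MonoidHom.mem_ker, hfι, ← MonoidHom.mem_ker, ← hTk]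
    exact Subgroup.subset_normalClosure t.2
  let c : H → f.ker → f.ker := fun h k => ⟨h * k * h⁻¹, f.normal_ker.conj_mem _ k.2 h⟩
  let r1 : f.ker × f.ker → FreeGroup α := fun x => a x.1 * a x.2 * (a (x.1 * x.2))⁻¹
  let r2 : α × f.ker → FreeGroup α := fun x =>
    FreeGroup.of x.1 * a x.2 * (FreeGroup.of x.1)⁻¹ * (a (c (ψ (FreeGroup.of x.1)) x.2))⁻¹
  let r3 : T → FreeGroup α := fun t => ι t * (a ⟨_, hTm t⟩)⁻¹
  let rels : Set (FreeGroup α) := Set.range r1 ∪ Set.range r2 ∪ Set.range r3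
  have : Finite T := hT
  have hrels : rels.Finite :=
    ((Set.finite_range r1).union (Set.finite_range r2)).union (Set.finite_range r3)
  let M := Subgroup.normalClosure rels
  have hM : M ≤ ψ.ker := by
    apply Subgroup.normalClosure_le_normal
    rintro _ ((⟨x, rfl⟩ | ⟨x, rfl⟩) | ⟨x, rfl⟩)
    · simp [r1, MonoidHom.mem_ker, hψa]
    · simp only [r2, SetLike.mem_coe, MonoidHom.mem_ker, map_mul, map_inv, hψa, c]
      simp
    · simp only [r3, SetLike.mem_coe, MonoidHom.mem_ker, map_mul, map_inv, hψa]
      simp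
  let q : FreeGroup α →* FreeGroup α ⧸ M := QuotientGroup.mk' M
  have hq : ∀ x ∈ rels, q x = 1 := fun x hx =>
    (QuotientGroup.eq_one_iff x).2 (Subgroup.subset_normalClosure hx)
  have e1 : ∀ k l, q (a (k * l)) = q (a k) * q (a l) := by
    intro k l
    have := hq _ (Or.inl (Or.inl ⟨(k, l), rfl⟩))
    simp only [r1, map_mul, map_inv] at this
    exact (mul_inv_eq_one.1 this).symm
  have e2 : ∀ x k, q (FreeGroup.of x) * q (a k) * (q (FreeGroup.of x))⁻¹
      = q (a (c (ψ (FreeGroup.of x)) k)) := by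
    intro x k
    have := hq _ (Or.inl (Or.inr ⟨(x, k), rfl⟩))
    simp only [r2, map_mul, map_inv] at this
    exact (mul_inv_eq_one.1 this)
  have e3 : ∀ t : T, q (ι t) = q (a ⟨_, hTm t⟩) := by
    intro t
    have := hq _ (Or.inr ⟨t, rfl⟩)
    simp only [r3, map_mul, map_inv] at this
    exact (mul_inv_eq_one.1 this)
  have cmul : ∀ x y k, c (x * y) k = c x (c y k) := by
    intro x y k
    apply Subtype.ext
    simp only [c]
    group
  have cone : ∀ k, c 1 k = k := by
    intro k
    apply Subtype.ext
    simp [c]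
  have e4 : ∀ w k, q w * q (a k) * (q w)⁻¹ = q (a (c (ψ w) k)) := by
    intro w
    induction w using FreeGroup.induction_on with
    | C1 => intro k; simp [cone]
    | of x => exact e2 x
    | inv_of x ih =>
      intro k
      have := ih (c (ψ (FreeGroup.of x))⁻¹ k)
      rw [← cmul, mul_inv_cancel, cone] at this
      rw [map_inv, map_inv, ← this]
      group
    | mul x y hx hy =>
      intro k
      rw [map_mul, map_mul, cmul, ← hx, ← hy]
      group
  let j : f.ker →* FreeGroup α ⧸ M := MonoidHom.mk' (fun k => q (a k)) e1
  have hL : j.range.Normal := by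
    constructor
    rintro _ ⟨k, rfl⟩ y
    obtain ⟨w, rfl⟩ := QuotientGroup.mk'_surjective M y
    exact ⟨c (ψ w) k, (e4 w k).symm⟩
  let s : FreeGroup α →* (FreeGroup α ⧸ M) ⧸ j.range := (QuotientGroup.mk' j.range).comp q
  have hs : ∀ k, s (a k) = 1 := fun k =>
    (QuotientGroup.eq_one_iff (q (a k))).2 ⟨k, rfl⟩
  have hsp : ∀ w, s (ι (p w)) = s w := by
    have : (s.comp ι).comp p = s := by
      ext i
      rcases i with i | k
      · simp [ι, p]
      · have := hs k
        simp only [a] at this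
        simp [p, this]
    intro u
    exact DFunLike.congr_fun this u
  have hφs : φ.ker ≤ (s.comp ι).ker := by
    rw [← hTk]
    apply Subgroup.normalClosure_le_normal
    intro t ht
    have h1 : s (ι t) = 1 := (QuotientGroup.eq_one_iff (q (ι t))).2 ⟨_, (e3 ⟨t, ht⟩).symm⟩
    exact h1
  refine Group.IsFinitelyPresented.of_surjective ψ hψ ⟨rels, hrels, le_antisymm hM ?_⟩
  intro w hw
  rw [MonoidHom.mem_ker] at hw
  have h1 : p w ∈ φ.ker := by rw [MonoidHom.mem_ker, hfp, hw, map_one]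
  have h2 : s w = 1 := by
    rw [← hsp]
    exact hφs h1
  obtain ⟨k, hk⟩ := (QuotientGroup.eq_one_iff (q w)).1 h2
  have hk' : q (a k) = q w := hk
  have h3 : (a k)⁻¹ * w ∈ M := QuotientGroup.eq.1 hk'
  have h4 := hM h3
  rw [MonoidHom.mem_ker, map_mul, map_inv, hψa, hw, mul_one, inv_eq_one] at h4
  have h5 : k = 1 := Subtype.ext h4
  have h6 : q w = 1 := by
    rw [← hk, h5, map_one]
  exact (QuotientGroup.eq_one_iff w).1 h6

/-- If `N` is a finite normal subgroup of `G` and `G/N` is coherent, then `G` is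
coherent. -/
theorem isCoherent_of_finite_normal_quotient
    {G : Type*} [Group G] (N : Subgroup G) [N.Normal] (hfin : Finite N)
    (hcoh : IsCoherent (G ⧸ N)) :
    IsCoherent G := by
  intro H hH
  let f := (QuotientGroup.mk' N).subgroupMap H
  have hf : Function.Surjective f := (QuotientGroup.mk' N).subgroupMap_surjective H
  have hfg : Group.FG (H.map (QuotientGroup.mk' N)) := Group.fg_of_surjective hf
  obtain ⟨m, rels, hr, ⟨e⟩⟩ := hcoh _ hfg
  have : Finite rels := hr
  have hQ : Group.IsFinitelyPresented (H.map (QuotientGroup.mk' N)) :=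
    Group.IsFinitelyPresented.equiv e
  have hker : ∀ x : f.ker, ((x : H) : G) ∈ N := by
    intro x
    have hx := congrArg Subtype.val (MonoidHom.mem_ker.1 x.2)
    exact (QuotientGroup.eq_one_iff _).1 hx
  have hfk : Finite f.ker := Finite.of_injective (fun x => (⟨_, hker x⟩ : N)) (by
    intro x y hxy
    have h : ((x : H) : G) = ((y : H) : G) := congrArg (fun z : N => (z : G)) hxy
    exact Subtype.ext (Subtype.ext h))
  have := fp_ext f hf hfk hQ
  obtain ⟨n, s, hs, ⟨e'⟩⟩ := Group.IsFinitelyPresented.exists_mulEquiv_presentedGroup (G := H)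
  exact ⟨n, s, hs, ⟨e'.symm⟩⟩
end
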